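/- arXiv:2602.07517 — 2 statements merged into one kernel-verified Lean document; each statement's English description precedes it below -/
import Mathlib

section
/- With the 1-positive (K−1)-negative sampling scheme, E[ log( (1/K) Σ_{i=1}^K r(Y_i) ) ] = KL( ℙ_Y ‖ Q^{⊗K} ) ≥ 0, where ℙ_Y is the marginal law of Y = (Y_1,…,Y_K); equivalently, E[ log Σ_{i=1}^K r(Y_i) ] ≥ log K. -/
open MeasureTheory Classical

/-- The conditional law of `Y = (Y_1, …, Y_K)` given `J = j` in the 1-positive
`(K−1)`-negative sampling scheme: the coordinates are independent with `Y_j ∼ P`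
and `Y_i ∼ Q` for `i ≠ j`. -/
noncomputable def condLaw {𝒴 : Type*} [MeasurableSpace 𝒴] (P Q : Measure 𝒴) {K : ℕ}
    (j : Fin K) : Measure (Fin K → 𝒴) :=
  Measure.pi (fun i => if i = j then P else Q)

/-- The marginal law `ℙ_Y` of `Y = (Y_1, …, Y_K)` in the 1-positive `(K−1)`-negative
sampling scheme (the index `J` is uniform on `{1, …, K}`). -/
noncomputable def margLaw {𝒴 : Type*} [MeasurableSpace 𝒴] (P Q : Measure 𝒴) (K : ℕ) :
    Measure (Fin K → 𝒴) :=
  (K : ENNReal)⁻¹ • ∑ j : Fin K, condLaw P Q j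

/-- The joint law of `(J, Y)` in the 1-positive `(K−1)`-negative sampling scheme:
`J` is uniform on `{1, …, K}` and, given `J = j`, `Y ∼ condLaw P Q j`. -/
noncomputable def jointLaw {𝒴 : Type*} [MeasurableSpace 𝒴] (P Q : Measure 𝒴) (K : ℕ) :
    Measure (Fin K × (Fin K → 𝒴)) :=
  (K : ENNReal)⁻¹ • ∑ j : Fin K, (condLaw P Q j).map (fun y => (j, y))

/-- The Kullback–Leibler divergence `KL(P‖Q) = ∫ log (dP/dQ) dP` when `P ≪ Q` and the
log-likelihood ratio is integrable, and `+∞` otherwise, as an extended real number. -/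
noncomputable def klDiv {α : Type*} [MeasurableSpace α] (P Q : Measure α) : EReal :=
  if P ≪ Q ∧ Integrable (llr P Q) P then ((∫ x, llr P Q x ∂P : ℝ) : EReal) else ⊤

/-- The expectation of a real random variable as an extended real number:
the difference of the lower integrals of the positive and negative parts. -/
noncomputable def expEReal {α : Type*} [MeasurableSpace α] (ν : Measure α) (f : α → ℝ) :
    EReal :=
  ((∫⁻ x, ENNReal.ofReal (f x) ∂ν : ENNReal) : EReal)
    - ((∫⁻ x, ENNReal.ofReal (-f x) ∂ν : ENNReal) : EReal)

lemma condLaw_eq {𝒴 : Type*} [MeasurableSpace 𝒴] (P Q : Measure 𝒴)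
    [IsProbabilityMeasure P] [IsProbabilityMeasure Q] (hPQ : P ≪ Q) {K : ℕ} (j : Fin K) :
    condLaw P Q j = (Measure.pi fun _ : Fin K => Q).withDensity
      (fun y => P.rnDeriv Q (y j)) := by
  unfold condLaw
  haveI : ∀ i : Fin K, SigmaFinite (if i = j then P else Q) := by
    intro i; split <;> infer_instance
  refine Measure.pi_eq fun s hs => ?_
  rw [withDensity_apply _ (MeasurableSet.univ_pi hs), Measure.restrict_pi_pi]
  have h1 : ∫⁻ y, P.rnDeriv Q (y j) ∂(Measure.pi fun i : Fin K => Q.restrict (s i))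
      = ∫⁻ z, P.rnDeriv Q z
        ∂((Measure.pi fun i : Fin K => Q.restrict (s i)).map (Function.eval j)) := by
    rw [lintegral_map (Measure.measurable_rnDeriv P Q) (measurable_pi_apply j)]
  rw [h1, Measure.pi_map_eval, lintegral_smul_measure, Measure.setLIntegral_rnDeriv hPQ,
    smul_eq_mul, ← Finset.prod_erase_mul Finset.univ _ (Finset.mem_univ j)]
  congr 1
  · refine Finset.prod_congr ?_ fun i hi => ?_
    · congr!
    · simp [Finset.ne_of_mem_erase hi]
  · simp

lemma margLaw_eq {𝒴 : Type*} [MeasurableSpace 𝒴] (P Q : Measure 𝒴)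
    [IsProbabilityMeasure P] [IsProbabilityMeasure Q] (hPQ : P ≪ Q) (K : ℕ) :
    margLaw P Q K = (Measure.pi fun _ : Fin K => Q).withDensity
      (fun y => (K : ENNReal)⁻¹ * ∑ i, P.rnDeriv Q (y i)) := by
  have hm : ∀ j : Fin K, Measurable fun y : Fin K → 𝒴 => P.rnDeriv Q (y j) := fun j =>
    (Measure.measurable_rnDeriv P Q).comp (measurable_pi_apply j)
  unfold margLaw
  ext s hs
  rw [withDensity_apply _ hs,
    lintegral_const_mul _ (Finset.measurable_fun_sum _ fun j _ => hm j),
    lintegral_finsetSum _ fun j _ => hm j]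
  simp [condLaw_eq P Q hPQ, withDensity_apply _ hs]

lemma margLaw_prob {𝒴 : Type*} [MeasurableSpace 𝒴] (P Q : Measure 𝒴)
    [IsProbabilityMeasure P] [IsProbabilityMeasure Q] (K : ℕ) (hK : K ≠ 0) :
    IsProbabilityMeasure (margLaw P Q K) := by
  have h : ∀ j : Fin K, condLaw P Q j Set.univ = 1 := by
    intro j
    haveI : ∀ i : Fin K, IsProbabilityMeasure (if i = j then P else Q) := by
      intro i; split <;> infer_instance
    unfold condLaw
    exact measure_univ
  constructor
  simp only [margLaw, Measure.smul_apply, Measure.finsetSum_apply, h]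
  simp only [Finset.sum_const, Finset.card_univ, Fintype.card_fin, nsmul_eq_mul, mul_one,
    smul_eq_mul]
  exact ENNReal.inv_mul_cancel (by exact_mod_cast hK) (ENNReal.natCast_ne_top K)

lemma lintegral_neg_llr_le {α : Type*} [MeasurableSpace α] (μ ν : Measure α)
    [IsProbabilityMeasure μ] [IsProbabilityMeasure ν] (h : μ ≪ ν) :
    ∫⁻ x, ENNReal.ofReal (-llr μ ν x) ∂μ ≤ 1 := by
  rw [← lintegral_rnDeriv_mul h
    (by exact ((measurable_llr μ ν).neg.ennreal_ofReal).aemeasurable)]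
  calc _ ≤ ∫⁻ _, 1 ∂ν := by
        refine lintegral_mono_ae ?_
        filter_upwards [Measure.rnDeriv_lt_top μ ν] with x hx
        rw [llr, ← ENNReal.ofReal_toReal hx.ne, ENNReal.toReal_ofReal ENNReal.toReal_nonneg,
          ← ENNReal.ofReal_mul ENNReal.toReal_nonneg, ← ENNReal.ofReal_one]
        refine ENNReal.ofReal_le_ofReal ?_
        rcases (ENNReal.toReal_nonneg (a := μ.rnDeriv ν x)).eq_or_lt with h0 | h0
        · simp [← h0]
        · have := Real.one_sub_inv_le_log_of_pos h0
          have h2 := mul_le_mul_of_nonneg_left this h0.le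
          rw [mul_sub, mul_inv_cancel₀ h0.ne'] at h2
          linarith
    _ = 1 := by simp

lemma expEReal_of_integrable {α : Type*} [MeasurableSpace α] (μ : Measure α) (f : α → ℝ)
    (hf : Integrable f μ) : expEReal μ f = ((∫ x, f x ∂μ : ℝ) : EReal) := by
  have h1 : ∫⁻ x, ENNReal.ofReal (f x) ∂μ ≠ ⊤ := hf.lintegral_lt_top.ne
  have h2 : ∫⁻ x, ENNReal.ofReal (-f x) ∂μ ≠ ⊤ := hf.neg.lintegral_lt_top.ne
  rw [integral_eq_lintegral_pos_part_sub_lintegral_neg_part hf, EReal.coe_sub]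
  unfold expEReal
  rw [EReal.coe_ennreal_toReal h1, EReal.coe_ennreal_toReal h2]

lemma expEReal_eq_top {α : Type*} [MeasurableSpace α] (μ : Measure α) (f : α → ℝ)
    (hf : AEStronglyMeasurable f μ) (hneg : ∫⁻ x, ENNReal.ofReal (-f x) ∂μ ≠ ⊤)
    (hni : ¬ Integrable f μ) : expEReal μ f = ⊤ := by
  have h1 : ∫⁻ x, ENNReal.ofReal (f x) ∂μ = ⊤ := by
    by_contra h
    refine hni ⟨hf, ?_⟩
    rw [hasFiniteIntegral_iff_norm]
    have : ∀ x, ENNReal.ofReal ‖f x‖ ≤ ENNReal.ofReal (f x) + ENNReal.ofReal (-f x) := by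
      intro x
      rw [Real.norm_eq_abs]
      rcases abs_cases (f x) with ⟨h, _⟩ | ⟨h, _⟩ <;> rw [h] <;> simp
    refine (lintegral_mono this).trans_lt ?_
    rw [lintegral_add_left' hf.aemeasurable.ennreal_ofReal]
    exact ENNReal.add_lt_top.2 ⟨lt_top_iff_ne_top.2 h, lt_top_iff_ne_top.2 hneg⟩
  unfold expEReal
  rw [h1, ← EReal.coe_ennreal_toReal hneg]
  simp

lemma expEReal_congr {α : Type*} [MeasurableSpace α] (μ : Measure α) {f g : α → ℝ}
    (h : f =ᵐ[μ] g) : expEReal μ f = expEReal μ g := by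
  unfold expEReal
  congr 2
  · exact lintegral_congr_ae (h.mono fun x hx => by simp only [hx])
  · exact lintegral_congr_ae (h.mono fun x hx => by simp only [hx])

/-- In the 1-positive `(K−1)`-negative sampling scheme,
`E[log ((1/K) ∑ i, r (Y_i))] = KL(ℙ_Y ‖ Q^{⊗K}) ≥ 0`, where `ℙ_Y` is the marginal law of
`Y = (Y_1, …, Y_K)`; equivalently, `E[log ∑ i, r (Y_i)] ≥ log K`. -/
theorem stmt_13 {𝒴 : Type*} [MeasurableSpace 𝒴]
    (P Q : Measure 𝒴) [IsProbabilityMeasure P] [IsProbabilityMeasure Q]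
    (hPQ : P ≪ Q) (r : 𝒴 → ENNReal) (hr : r = P.rnDeriv Q)
    (K : ℕ) (hK : 2 ≤ K) :
    expEReal (margLaw P Q K)
        (fun y => Real.log (((K : ENNReal)⁻¹ * ∑ i, r (y i)).toReal))
      = klDiv (margLaw P Q K) (Measure.pi fun _ : Fin K => Q) ∧
      0 ≤ klDiv (margLaw P Q K) (Measure.pi fun _ : Fin K => Q) ∧
      ((Real.log K : ℝ) : EReal)
        ≤ expEReal (margLaw P Q K) (fun y => Real.log ((∑ i, r (y i)).toReal)) := by
  subst hr
  have hK0 : K ≠ 0 := by omega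
  have hprob := margLaw_prob P Q K hK0
  set ν := Measure.pi fun _ : Fin K => Q with hν
  set g : (Fin K → 𝒴) → ENNReal := fun y => (K : ENNReal)⁻¹ * ∑ i, P.rnDeriv Q (y i) with hg
  have hgm : Measurable g := by
    refine Measurable.const_mul (Finset.measurable_fun_sum _ fun j _ => ?_) _
    exact (Measure.measurable_rnDeriv P Q).comp (measurable_pi_apply j)
  have hM : margLaw P Q K = ν.withDensity g := margLaw_eq P Q hPQ K
  set μ := margLaw P Q K with hμ
  have hac : μ ≪ ν := by rw [hM]; exact withDensity_absolutelyContinuous _ _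
  have hrn : μ.rnDeriv ν =ᵐ[μ] g := by
    apply hac.ae_le
    rw [hM]
    exact Measure.rnDeriv_withDensity ν hgm
  have hllr : llr μ ν =ᵐ[μ] fun y => Real.log (g y).toReal :=
    hrn.mono fun y hy => by simp only [llr, hy]
  have hneg : ∫⁻ x, ENNReal.ofReal (-llr μ ν x) ∂μ ≠ ⊤ :=
    ((lintegral_neg_llr_le μ ν hac).trans_lt ENNReal.one_lt_top).ne
  have hkl : expEReal μ (llr μ ν) = klDiv μ ν := by
    unfold klDiv
    by_cases hi : Integrable (llr μ ν) μ
    · rw [if_pos ⟨hac, hi⟩, expEReal_of_integrable _ _ hi]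
    · rw [if_neg (fun h => hi h.2), expEReal_eq_top _ _
        (measurable_llr μ ν).aestronglyMeasurable hneg hi]
  have hgibbs : Integrable (llr μ ν) μ → 0 ≤ ∫ x, llr μ ν x ∂μ := by
    intro hi
    have := InformationTheory.integral_llr_add_sub_measure_univ_nonneg hac hi
    simpa using this
  have hlog : (fun y : Fin K → 𝒴 => Real.log ((∑ i, P.rnDeriv Q (y i)).toReal))
      =ᵐ[μ] fun y => Real.log K + llr μ ν y := by
    filter_upwards [hrn, Measure.rnDeriv_pos hac, hac.ae_le (Measure.rnDeriv_lt_top μ ν)]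
      with y h1 h2 h3
    have h4 : (g y).toReal = (K : ℝ)⁻¹ * (∑ i, P.rnDeriv Q (y i)).toReal := by
      simp [hg, ENNReal.toReal_mul]
    have h5 : 0 < (g y).toReal := by
      rw [← h1]; exact ENNReal.toReal_pos h2.ne' h3.ne
    have hKr : (K : ℝ) ≠ 0 := by exact_mod_cast hK0
    have h6 : (∑ i, P.rnDeriv Q (y i)).toReal = K * (g y).toReal := by
      rw [h4]; field_simp
    rw [h6, Real.log_mul hKr h5.ne', llr, h1]
  refine ⟨?_, ?_, ?_⟩
  · rw [← hkl]
    exact expEReal_congr μ hllr.symm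
  · unfold klDiv
    split_ifs with h
    · exact_mod_cast hgibbs h.2
    · exact le_top
  · rw [expEReal_congr μ hlog]
    have hlK : 0 ≤ Real.log K := Real.log_natCast_nonneg K
    by_cases hi : Integrable (llr μ ν) μ
    · have hi2 : Integrable (fun y => Real.log K + llr μ ν y) μ := (integrable_const _).add hi
      rw [expEReal_of_integrable _ _ hi2, integral_add (integrable_const _) hi]
      have := hgibbs hi
      rw [EReal.coe_le_coe_iff]
      simpa using this
    · rw [expEReal_eq_top]
      · exact le_top
      · exact ((measurable_llr μ ν).const_add _).aestronglyMeasurable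
      · refine ne_top_of_le_ne_top hneg (lintegral_mono fun x => ?_)
        exact ENNReal.ofReal_le_ofReal (by linarith)
      · intro h
        refine hi ?_
        have := h.sub (integrable_const (Real.log K))
        refine this.congr (Filter.Eventually.of_forall fun x => ?_)
        simp
end

section
/- With the 1-positive (K−1)-negative sampling scheme, define the Bayes log-loss 𝓛* := E[ −log ℙ(J = · | Y) evaluated at J ] = E[ −log ( r(Y_J)/Σ_{i=1}^K r(Y_i) ) ]. Then log K − 𝓛* ≤ KL(P‖Q); equivalently, 𝓛* ≥ log K − KL(P‖Q). -/
open MeasureTheory Classical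

instance condLaw_isProb {𝒴 : Type*} [MeasurableSpace 𝒴] (P Q : Measure 𝒴)
    [IsProbabilityMeasure P] [IsProbabilityMeasure Q] {K : ℕ} (j i : Fin K) :
    IsProbabilityMeasure (if i = j then P else Q) := by
  split_ifs <;> infer_instance

lemma condLaw_eq_withDensity {𝒴 : Type*} [MeasurableSpace 𝒴] (P Q : Measure 𝒴)
    [IsProbabilityMeasure P] [IsProbabilityMeasure Q] (hPQ : P ≪ Q) {K : ℕ} (j : Fin K) :
    condLaw P Q j
      = (Measure.pi (fun _ : Fin K => Q)).withDensity (fun y => P.rnDeriv Q (y j)) := by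
  unfold condLaw
  apply Measure.pi_eq
  intro s hs
  have hr := Measure.measurable_rnDeriv P Q
  rw [withDensity_apply _ (MeasurableSet.univ_pi hs), ← lintegral_indicator
    (MeasurableSet.univ_pi hs)]
  let g : Fin K → 𝒴 → ENNReal := fun i =>
    (s i).indicator (fun x => if i = j then P.rnDeriv Q x else 1)
  have hg : ∀ i, Measurable (g i) := by
    intro i
    refine Measurable.indicator ?_ (hs i)
    by_cases h : i = j
    · simpa [h] using hr
    · simp [h]
  have hind : ProbabilityTheory.iIndepFun (fun i (ω : Fin K → 𝒴) => g i (ω i))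
      (Measure.pi (fun _ : Fin K => Q)) :=
    ProbabilityTheory.iIndepFun_pi (fun i => (hg i).aemeasurable)
  have h1 := ProbabilityTheory.lintegral_prod_eq_prod_lintegral_of_indepFun Finset.univ _ hind
    (fun i => (hg i).comp (measurable_pi_apply i))
  have h2 : ∀ y : Fin K → 𝒴, (Set.univ.pi s).indicator (fun y => P.rnDeriv Q (y j)) y
      = ∏ i, g i (y i) := by
    intro y
    by_cases hy : y ∈ Set.univ.pi s
    · rw [Set.indicator_of_mem hy]
      have : ∀ i, g i (y i) = if i = j then P.rnDeriv Q (y i) else 1 := fun i =>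
        Set.indicator_of_mem (hy i (Set.mem_univ i)) _
      simp [this]
    · rw [Set.indicator_of_notMem hy]
      simp only [Set.mem_univ_pi, not_forall] at hy
      obtain ⟨i, hi⟩ := hy
      exact (Finset.prod_eq_zero (Finset.mem_univ i) (Set.indicator_of_notMem hi _)).symm
  simp_rw [h2]
  rw [h1]
  refine Finset.prod_congr rfl (fun i _ => ?_)
  have h3 := (measurePreserving_eval (fun _ : Fin K => Q) i).lintegral_comp (hg i)
  refine h3.trans ?_
  rw [lintegral_indicator (hs i)]
  by_cases h : i = j
  · simp only [h, if_true]
    rw [Measure.setLIntegral_rnDeriv hPQ]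
  · simp [h]

lemma sum_lintegral_le {𝒴 : Type*} [MeasurableSpace 𝒴] (P Q : Measure 𝒴)
    [IsProbabilityMeasure P] [IsProbabilityMeasure Q] (hPQ : P ≪ Q) (K : ℕ) :
    ∑ j : Fin K, ∫⁻ y, (∑ i, P.rnDeriv Q (y i))⁻¹ ∂(condLaw P Q j) ≤ 1 := by
  have hr := Measure.measurable_rnDeriv P Q
  have hrj : ∀ j : Fin K, Measurable (fun y : Fin K → 𝒴 => P.rnDeriv Q (y j)) :=
    fun j => hr.comp (measurable_pi_apply j)
  have hS : Measurable (fun y : Fin K → 𝒴 => (∑ i, P.rnDeriv Q (y i))⁻¹) :=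
    (Finset.measurable_fun_sum _ (fun i _ => hrj i)).inv
  have h : ∀ j : Fin K, ∫⁻ y, (∑ i, P.rnDeriv Q (y i))⁻¹ ∂(condLaw P Q j)
      = ∫⁻ y, P.rnDeriv Q (y j) * (∑ i, P.rnDeriv Q (y i))⁻¹
        ∂(Measure.pi (fun _ : Fin K => Q)) := by
    intro j
    rw [condLaw_eq_withDensity P Q hPQ j, lintegral_withDensity_eq_lintegral_mul _ (hrj j) hS]
    rfl
  simp_rw [h]
  rw [← lintegral_finsetSum Finset.univ
    (f := fun (j : Fin K) (y : Fin K → 𝒴) => P.rnDeriv Q (y j) * (∑ i, P.rnDeriv Q (y i))⁻¹)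
    (fun j _ => (hrj j).mul hS)]
  calc _ ≤ ∫⁻ y, 1 ∂(Measure.pi (fun _ : Fin K => Q)) := by
        refine lintegral_mono (fun y => ?_)
        dsimp only
        rw [← Finset.sum_mul, ← div_eq_mul_inv]
        exact ENNReal.div_self_le_one
    _ = 1 := by simp

lemma pointwise_bound (a S : ENNReal) (ha0 : 0 < a) (haS : a ≤ S) (hS : S ≠ ⊤) (K : ℕ)
    (hK : 0 < K) :
    Real.log K + 1 ≤ (ENNReal.ofReal (-Real.log (a / S).toReal)).toReal + Real.log a.toReal
      + K * (S⁻¹).toReal := by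
  have haT : a ≠ ⊤ := ne_top_of_le_ne_top hS haS
  have hS0 : 0 < S := ha0.trans_le haS
  have h1 : 0 < a.toReal := ENNReal.toReal_pos ha0.ne' haT
  have h2 : 0 < S.toReal := ENNReal.toReal_pos hS0.ne' hS
  have hKr : (0 : ℝ) < K := by exact_mod_cast hK
  have h3 : -Real.log (a / S).toReal
      ≤ (ENNReal.ofReal (-Real.log (a / S).toReal)).toReal := by
    rw [ENNReal.toReal_ofReal']; exact le_max_left _ _
  rw [ENNReal.toReal_div, Real.log_div h1.ne' h2.ne'] at h3
  rw [ENNReal.toReal_div, Real.log_div h1.ne' h2.ne', ENNReal.toReal_inv]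
  have h4 := Real.log_le_sub_one_of_pos (div_pos hKr h2)
  rw [Real.log_div hKr.ne' h2.ne', div_eq_mul_inv] at h4
  linarith

lemma cond_bound {𝒴 : Type*} [MeasurableSpace 𝒴] (P Q : Measure 𝒴)
    [IsProbabilityMeasure P] [IsProbabilityMeasure Q] (hPQ : P ≪ Q)
    (hint : Integrable (llr P Q) P) (K : ℕ) (hK : 0 < K) (j : Fin K)
    (hL : ∫⁻ y, ENNReal.ofReal (-Real.log ((P.rnDeriv Q (y j)
      / ∑ i, P.rnDeriv Q (y i)).toReal)) ∂(condLaw P Q j) ≠ ⊤)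
    (hD : ∫⁻ y, (∑ i, P.rnDeriv Q (y i))⁻¹ ∂(condLaw P Q j) ≠ ⊤) :
    Real.log K + 1 ≤ (∫⁻ y, ENNReal.ofReal (-Real.log ((P.rnDeriv Q (y j)
      / ∑ i, P.rnDeriv Q (y i)).toReal)) ∂(condLaw P Q j)).toReal + ∫ x, llr P Q x ∂P
      + K * (∫⁻ y, (∑ i, P.rnDeriv Q (y i))⁻¹ ∂(condLaw P Q j)).toReal := by
  have hr := Measure.measurable_rnDeriv P Q
  have hrj : ∀ j : Fin K, Measurable (fun y : Fin K → 𝒴 => P.rnDeriv Q (y j)) :=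
    fun j => hr.comp (measurable_pi_apply j)
  have hSm : Measurable (fun y : Fin K → 𝒴 => ∑ i, P.rnDeriv Q (y i)) :=
    Finset.measurable_fun_sum _ (fun i _ => hrj i)
  have hfm : Measurable (fun y : Fin K → 𝒴 => ENNReal.ofReal (-Real.log ((P.rnDeriv Q (y j)
      / ∑ i, P.rnDeriv Q (y i)).toReal))) :=
    (Real.measurable_log.comp ((hrj j).div hSm).ennreal_toReal).neg.ennreal_ofReal
  have : IsProbabilityMeasure (condLaw P Q j) := by unfold condLaw; infer_instance
  have hmp : ∀ i, MeasurePreserving (Function.eval i) (condLaw P Q j)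
      (if i = j then P else Q) := fun i =>
    measurePreserving_eval (fun i => if i = j then P else Q) i
  have hmpj : MeasurePreserving (Function.eval j) (condLaw P Q j) P := by
    simpa using hmp j
  have hpos : ∀ᵐ y ∂(condLaw P Q j), 0 < P.rnDeriv Q (y j) :=
    hmpj.quasiMeasurePreserving.ae (Measure.rnDeriv_pos hPQ)
  have hfin : ∀ᵐ y ∂(condLaw P Q j), ∀ i, P.rnDeriv Q (y i) ≠ ⊤ := by
    rw [ae_all_iff]
    intro i
    refine (hmp i).quasiMeasurePreserving.ae (p := fun x => P.rnDeriv Q x ≠ ⊤) ?_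
    split_ifs
    · exact hPQ.ae_le (Measure.rnDeriv_ne_top P Q)
    · exact Measure.rnDeriv_ne_top P Q
  have hllr : Integrable (fun y : Fin K → 𝒴 => llr P Q (y j)) (condLaw P Q j) :=
    hmpj.integrable_comp_of_integrable hint
  have hllr' : ∫ y, llr P Q (y j) ∂(condLaw P Q j) = ∫ x, llr P Q x ∂P := by
    have h := integral_map (μ := condLaw P Q j) (f := llr P Q) hmpj.measurable.aemeasurable
      (by rw [hmpj.map_eq]; exact hint.aestronglyMeasurable)
    rw [hmpj.map_eq] at h
    exact h.symm
  have hi1 := integrable_toReal_of_lintegral_ne_top hfm.aemeasurable hL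
  have hi2 := integrable_toReal_of_lintegral_ne_top hSm.inv.aemeasurable hD
  have e1 := integral_toReal hfm.aemeasurable (ae_lt_top hfm hL)
  have e2 := integral_toReal hSm.inv.aemeasurable (ae_lt_top hSm.inv hD)
  simp only [Pi.inv_apply] at hi2 e2
  rw [← e1, ← e2, ← hllr', ← integral_const_mul, ← integral_add hi1 hllr,
    ← integral_add (f := fun y => _ + _) (hi1.add hllr) (hi2.const_mul _)]
  have h0 : ∫ _y : Fin K → 𝒴, (Real.log K + 1) ∂(condLaw P Q j) = Real.log K + 1 := by simp
  rw [← h0]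
  refine integral_mono_ae (integrable_const _) ((hi1.add hllr).add (hi2.const_mul _)) ?_
  filter_upwards [hpos, hfin] with y hy1 hy2
  exact pointwise_bound _ _ hy1
    (Finset.single_le_sum (f := fun i => P.rnDeriv Q (y i)) (fun i _ => zero_le)
      (Finset.mem_univ j))
    (ENNReal.sum_ne_top.2 (fun i _ => hy2 i)) K hK

/-- In the 1-positive `(K−1)`-negative sampling scheme, define the
Bayes log-loss `𝓛* := E[−log (r (Y_J) / ∑ i, r (Y_i))]` (the integrand is a.s.
nonnegative since the posterior ratio lies in `[0,1]`).  Then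
`log K − 𝓛* ≤ KL(P‖Q)`; equivalently, `𝓛* ≥ log K − KL(P‖Q)`. -/
theorem stmt_14 {𝒴 : Type*} [MeasurableSpace 𝒴]
    (P Q : Measure 𝒴) [IsProbabilityMeasure P] [IsProbabilityMeasure Q]
    (hPQ : P ≪ Q) (r : 𝒴 → ENNReal) (hr : r = P.rnDeriv Q)
    (K : ℕ) (hK : 2 ≤ K)
    (Lstar : ENNReal)
    (hLstar : Lstar = ∫⁻ z, ENNReal.ofReal
        (-Real.log ((r (z.2 z.1) / ∑ i, r (z.2 i)).toReal)) ∂(jointLaw P Q K)) :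
    ((Real.log K : ℝ) : EReal) - (Lstar : EReal) ≤ klDiv P Q := by
  subst hr
  unfold klDiv
  split_ifs with h
  swap
  · exact le_top
  obtain ⟨-, hint⟩ := h
  by_cases hT : Lstar = ⊤
  · simp [hT]
  have hK0 : 0 < K := by omega
  have hKr : (0 : ℝ) < K := by exact_mod_cast hK0
  have hr := Measure.measurable_rnDeriv P Q
  have hL : Lstar = (K : ENNReal)⁻¹ * ∑ j : Fin K, ∫⁻ y, ENNReal.ofReal
      (-Real.log ((P.rnDeriv Q (y j) / ∑ i, P.rnDeriv Q (y i)).toReal)) ∂(condLaw P Q j) := by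
    rw [hLstar, jointLaw, lintegral_smul_measure, lintegral_finsetSum_measure, smul_eq_mul]
    congr 1
    refine Finset.sum_congr rfl (fun j _ => ?_)
    rw [lintegral_map' _ measurable_prodMk_left.aemeasurable]
    refine Measurable.aemeasurable ?_
    refine measurable_from_prod_countable_right (fun k => ?_)
    have hrj : ∀ j : Fin K, Measurable (fun y : Fin K → 𝒴 => P.rnDeriv Q (y j)) :=
      fun j => hr.comp (measurable_pi_apply j)
    have hSm : Measurable (fun y : Fin K → 𝒴 => ∑ i, P.rnDeriv Q (y i)) :=
      Finset.measurable_fun_sum _ (fun i _ => hrj i)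
    exact (Real.measurable_log.comp ((hrj k).div hSm).ennreal_toReal).neg.ennreal_ofReal
  have hD := sum_lintegral_le P Q hPQ K
  have hDj : ∀ j : Fin K, ∫⁻ y, (∑ i, P.rnDeriv Q (y i))⁻¹ ∂(condLaw P Q j) ≠ ⊤ := fun j =>
    ENNReal.sum_ne_top.1 (ne_top_of_le_ne_top ENNReal.one_ne_top hD) j (Finset.mem_univ j)
  have hsum : ∑ j : Fin K, ∫⁻ y, ENNReal.ofReal
      (-Real.log ((P.rnDeriv Q (y j) / ∑ i, P.rnDeriv Q (y i)).toReal)) ∂(condLaw P Q j)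
      ≠ ⊤ := by
    intro h
    rw [h, ENNReal.mul_top (by simp)] at hL
    exact hT hL
  have hLj := fun j => ENNReal.sum_ne_top.1 hsum j (Finset.mem_univ j)
  have hb := Finset.sum_le_sum (fun j (_ : j ∈ (Finset.univ : Finset (Fin K))) =>
    cond_bound P Q hPQ hint K hK0 j (hLj j) (hDj j))
  rw [Finset.sum_add_distrib, Finset.sum_add_distrib, Finset.sum_add_distrib, ← Finset.mul_sum,
    ← ENNReal.toReal_sum (fun j _ => hLj j), ← ENNReal.toReal_sum (fun j _ => hDj j)] at hb
  have hD' := ENNReal.toReal_mono ENNReal.one_ne_top hD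
  rw [ENNReal.toReal_one] at hD'
  have hLr := congrArg ENNReal.toReal hL
  rw [ENNReal.toReal_mul, ENNReal.toReal_inv, ENNReal.toReal_natCast] at hLr
  simp only [Finset.sum_const, Finset.card_univ, Fintype.card_fin, nsmul_eq_mul] at hb
  have hLr2 := congrArg (fun x : ℝ => (K : ℝ) * x) hLr
  simp only [mul_inv_cancel_left₀ hKr.ne'] at hLr2
  rw [← hLr2] at hb
  have hfinal : Real.log K - Lstar.toReal ≤ ∫ x, llr P Q x ∂P := by
    have : (K : ℝ) * (Real.log K + 1) ≤ K * (Lstar.toReal + ∫ x, llr P Q x ∂P + 1) := by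
      nlinarith
    have := le_of_mul_le_mul_left this hKr
    linarith
  rw [← EReal.coe_ennreal_toReal hT, ← EReal.coe_sub]
  exact_mod_cast hfinal
end
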